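/- Let W be a nonempty word over A^{±1} and n ≥ 0 an integer. Then W is a product of at most n conjugates of the words (a_2a_1^{n_1}a_2^{-1}a_1^{-n_2})^{±1} in F(A) if and only if there is a finite sequence Ω of elementary operations that transforms the empty pseudobracket system for W (with respect to presentation (1.4)) into a final pseudobracket system {(0, |W|, 0, n')} with n' ≤ n, such that Ω has size bounded by (7|W|, C(log|W|_{\bar a_1} + 1)) where C = (log(6/5))^{-1}, log denotes the base-2 logarithm (with the convention log|W|_{\bar a_1} := 0 if |W|_{\bar a_1} = 0), and every pseudobracket b occurring in an intermediate pseudobracket system of the corresponding sequence satisfies |b(3)| ≤ (|W|_{a_1} + (|n_1| + |n_2|)n)/2. [Lemma 6.13] -/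

import Mathlib

namespace Stmt13

/-- Words over the alphabet `A^{±1}` where `A = {a_1, a_2, ..., a_{m+2}}` (at least two
generators; `a_1` is the letter `0` and `a_2` is the letter `1`). -/
abbrev Word (m : ℕ) := List (Fin (m + 2) × Bool)

/-- The image of a word in the free group `F(A)`. -/
def evalW {m : ℕ} (w : Word m) : FreeGroup (Fin (m + 2)) := FreeGroup.mk w

/-- The generator `a_1` as an element of `F(A)`. -/
def a1g (m : ℕ) : FreeGroup (Fin (m + 2)) := FreeGroup.of 0

/-- The Baumslag–Solitar relator `r = a_2 a_1^{n_1} a_2^{-1} a_1^{-n_2}` of the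
presentation (1.4). -/
def relBS (m : ℕ) (n1 n2 : ℤ) : FreeGroup (Fin (m + 2)) :=
  FreeGroup.of 1 * FreeGroup.of 0 ^ n1 * (FreeGroup.of 1)⁻¹ * FreeGroup.of 0 ^ (-n2)

/-- `g` is a product of exactly `n` conjugates of elements of `R ∪ R⁻¹`. -/
def IsProdConj {G : Type*} [Group G] (R : Set G) (n : ℕ) (g : G) : Prop :=
  ∃ r s : Fin n → G,
    (∀ i, r i ∈ R ∨ (r i)⁻¹ ∈ R) ∧
    g = (List.ofFn fun i => s i * r i * (s i)⁻¹).prod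

/-- `|U|_{a_1}`: the number of occurrences of `a_1^{±1}` in `U`. -/
def countA1 {m : ℕ} (U : Word m) : ℕ := U.countP fun x => decide (x.1 = (0 : Fin (m + 2)))

/-- `|U|_{\bar a_1} := |U| - |U|_{a_1}`. -/
def noA1 {m : ℕ} (U : Word m) : ℕ := U.countP fun x => decide (x.1 ≠ (0 : Fin (m + 2)))

/-- The sign `ε = ±1` of a letter. -/
def sgn (ε : Bool) : ℤ := if ε then 1 else -1

/-- A pseudobracket for presentation (1.4): the 4-tuple `(b(1), b(2), b(3), b(4))` of
integers with `b(1), b(2), b(4) ≥ 0`. -/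
structure PB where
  c1 : ℕ
  c2 : ℕ
  c3 : ℤ
  c4 : ℕ
deriving DecidableEq

/-- A pseudobracket for the word `W`: `0 ≤ b(1) ≤ b(2) ≤ |W|` and `b(4) ≥ 0`. -/
def ValidPB {m : ℕ} (W : Word m) (b : PB) : Prop := b.c1 ≤ b.c2 ∧ b.c2 ≤ W.length

/-- A pseudobracket system for `W`: a finite set of pseudobrackets such that for
distinct `b, c` either `b(2) ≤ c(1)` or `c(2) ≤ b(1)`. -/
def IsPBS {m : ℕ} (W : Word m) (B : Finset PB) : Prop :=
  (∀ b ∈ B, ValidPB W b) ∧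
    ∀ b ∈ B, ∀ c ∈ B, b ≠ c → b.c2 ≤ c.c1 ∨ c.c2 ≤ b.c1

/-- The elementary operations over pseudobracket systems for `W` with respect to
presentation (1.4): additions, extensions of types 1–3 and mergers; each operation is
required to produce again a pseudobracket system. -/
inductive Step (m : ℕ) (n1 n2 : ℤ) (W : Word m) : Finset PB → Finset PB → Prop
  | add (B : Finset PB) (v : ℕ) (hv : v ≤ W.length)
      (hnot : (⟨v, v, 0, 0⟩ : PB) ∉ B)
      (hpbs : IsPBS W (insert (⟨v, v, 0, 0⟩ : PB) B)) :
      Step m n1 n2 W B (insert (⟨v, v, 0, 0⟩ : PB) B)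
  | ext1L (B : Finset PB) (b b' : PB) (hb : b ∈ B) (ε : Bool) (hl : 1 ≤ b.c1)
      (hlet : W[b.c1 - 1]? = some ((0 : Fin (m + 2)), ε))
      (hb' : b' = ⟨b.c1 - 1, b.c2, b.c3 + sgn ε, b.c4⟩)
      (hpbs : IsPBS W (insert b' (B.erase b))) :
      Step m n1 n2 W B (insert b' (B.erase b))
  | ext1R (B : Finset PB) (b b' : PB) (hb : b ∈ B) (ε : Bool)
      (hlet : W[b.c2]? = some ((0 : Fin (m + 2)), ε))
      (hb' : b' = ⟨b.c1, b.c2 + 1, b.c3 + sgn ε, b.c4⟩)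
      (hpbs : IsPBS W (insert b' (B.erase b))) :
      Step m n1 n2 W B (insert b' (B.erase b))
  | ext2pos (B : Finset PB) (b b' : PB) (hb : b ∈ B) (hl : 1 ≤ b.c1)
      (hlet1 : W[b.c1 - 1]? = some ((1 : Fin (m + 2)), true))
      (hlet2 : W[b.c2]? = some ((1 : Fin (m + 2)), false))
      (hs : b.c3 ≠ 0) (hdvd : n1 ∣ b.c3)
      (hb' : b' = ⟨b.c1 - 1, b.c2 + 1, b.c3 / n1 * n2, b.c4 + (b.c3 / n1).natAbs⟩)
      (hpbs : IsPBS W (insert b' (B.erase b))) :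
      Step m n1 n2 W B (insert b' (B.erase b))
  | ext2neg (B : Finset PB) (b b' : PB) (hb : b ∈ B) (hl : 1 ≤ b.c1)
      (hlet1 : W[b.c1 - 1]? = some ((1 : Fin (m + 2)), false))
      (hlet2 : W[b.c2]? = some ((1 : Fin (m + 2)), true))
      (hs : b.c3 ≠ 0) (hdvd : n2 ∣ b.c3)
      (hb' : b' = ⟨b.c1 - 1, b.c2 + 1, b.c3 / n2 * n1, b.c4 + (b.c3 / n2).natAbs⟩)
      (hpbs : IsPBS W (insert b' (B.erase b))) :
      Step m n1 n2 W B (insert b' (B.erase b))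
  | ext3 (B : Finset PB) (b b' : PB) (hb : b ∈ B) (hs : b.c3 = 0)
      (i : Fin (m + 2)) (ε : Bool) (hi : i ≠ 0) (hl : 1 ≤ b.c1)
      (hlet1 : W[b.c1 - 1]? = some (i, ε)) (hlet2 : W[b.c2]? = some (i, !ε))
      (hb' : b' = ⟨b.c1 - 1, b.c2 + 1, 0, b.c4⟩)
      (hpbs : IsPBS W (insert b' (B.erase b))) :
      Step m n1 n2 W B (insert b' (B.erase b))
  | merge (B : Finset PB) (b c b' : PB) (hb : b ∈ B) (hc : c ∈ B) (hbc : b ≠ c)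
      (hr : b.c2 = c.c1)
      (hb' : b' = ⟨b.c1, c.c2, b.c3 + c.c3, b.c4 + c.c4⟩)
      (hpbs : IsPBS W (insert b' ((B.erase b).erase c))) :
      Step m n1 n2 W B (insert b' ((B.erase b).erase c))

/-- The constant `C = (log (6/5))⁻¹` (base-2 logarithm). -/
noncomputable def Cconst : ℝ := (Real.logb 2 (6 / 5))⁻¹

/-! ### Bracketing derivations -/

/-- The inverse letter. -/
def linv {m : ℕ} (x : Fin (m + 2) × Bool) : Fin (m + 2) × Bool := (x.1, !x.2)

@[simp] theorem linv_linv {m : ℕ} (x : Fin (m + 2) × Bool) : linv (linv x) = x := by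
  simp [linv]

@[simp] theorem linv_fst {m : ℕ} (x : Fin (m + 2) × Bool) : (linv x).1 = x.1 := rfl

/-- `x a_1^e x⁻¹` is turned into `a_1^f` at cost `c`. -/
def Conv {m : ℕ} (n1 n2 : ℤ) (x : Fin (m + 2) × Bool) (e f : ℤ) (c : ℕ) : Prop :=
  x.1 ≠ 0 ∧ ∃ q : ℤ, (x.1 ≠ 1 → q = 0) ∧ e = (if x.2 then n1 else n2) * q ∧
    f = (if x.2 then n2 else n1) * q ∧ c = q.natAbs

theorem Conv.zero {m : ℕ} {n1 n2 : ℤ} {x : Fin (m + 2) × Bool} (hx : x.1 ≠ 0) :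
    Conv n1 n2 x 0 0 0 := ⟨hx, 0, by simp⟩

theorem Conv.symm {m : ℕ} {n1 n2 : ℤ} {x : Fin (m + 2) × Bool} {e f : ℤ} {c : ℕ}
    (h : Conv n1 n2 x e f c) : Conv n1 n2 (linv x) f e c := by
  obtain ⟨hx, q, hq, he, hf, hc⟩ := h
  refine ⟨hx, q, hq, ?_, ?_, hc⟩
  · rw [hf]; cases h : x.2 <;> simp [linv, h]
  · rw [he]; cases h : x.2 <;> simp [linv, h]

theorem Conv.add {m : ℕ} {n1 n2 : ℤ} {x : Fin (m + 2) × Bool} {e f e' f' : ℤ} {c c' : ℕ}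
    (h : Conv n1 n2 x e f c) (h' : Conv n1 n2 x e' f' c') :
    ∃ d ≤ c + c', Conv n1 n2 x (e + e') (f + f') d := by
  obtain ⟨hx, q, hq, rfl, rfl, rfl⟩ := h
  obtain ⟨_, q', hq', rfl, rfl, rfl⟩ := h'
  refine ⟨(q + q').natAbs, Int.natAbs_add_le _ _, hx, q + q', ?_, by ring, by ring, rfl⟩
  intro h; rw [hq h, hq' h]; rfl

theorem Conv.sub {m : ℕ} {n1 n2 : ℤ} {x : Fin (m + 2) × Bool} {e f e' f' : ℤ} {c c' : ℕ}
    (h : Conv n1 n2 x e f c) (h' : Conv n1 n2 x e' f' c') :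
    ∃ d ≤ c + c', Conv n1 n2 x (e - e') (f - f') d := by
  obtain ⟨hx, q, hq, rfl, rfl, rfl⟩ := h
  obtain ⟨_, q', hq', rfl, rfl, rfl⟩ := h'
  refine ⟨(q - q').natAbs, Int.natAbs_sub_le _ _, hx, q - q', ?_, by ring, by ring, rfl⟩
  intro h; rw [hq h, hq' h]; rfl

theorem Conv.of_zero {m : ℕ} {n1 n2 : ℤ} (hn1 : n1 ≠ 0) (hn2 : n2 ≠ 0)
    {x : Fin (m + 2) × Bool} {f : ℤ} {c : ℕ}
    (h : Conv n1 n2 x 0 f c) : f = 0 := by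
  obtain ⟨hx, q, hq, h0, rfl, rfl⟩ := h
  have : (if x.2 then n1 else n2) ≠ 0 := by split_ifs <;> assumption
  have : q = 0 := by
    rcases mul_eq_zero.1 h0.symm with h | h
    · exact absurd h this
    · exact h
  simp [this]

/-- `U` brackets to `a_1^e` with cost at most `k`. -/
inductive Der {m : ℕ} (n1 n2 : ℤ) : Word m → ℤ → ℕ → Prop
  | nil (k : ℕ) : Der n1 n2 [] 0 k
  | cons (ε : Bool) (U : Word m) (e : ℤ) (k : ℕ) (h : Der n1 n2 U e k) :
      Der n1 n2 ((0, ε) :: U) (sgn ε + e) k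
  | band (x : Fin (m + 2) × Bool) (P Q : Word m) (e e' f : ℤ) (c k l : ℕ)
      (hc : Conv n1 n2 x e e' c) (hP : Der n1 n2 P e k) (hQ : Der n1 n2 Q f l) :
      Der n1 n2 (x :: (P ++ linv x :: Q)) (e' + f) (k + c + l)

section
variable {m : ℕ} {n1 n2 : ℤ}

theorem Der.mono {U : Word m} {e : ℤ} {k : ℕ} (h : Der n1 n2 U e k) :
    ∀ k', k ≤ k' → Der n1 n2 U e k' := by
  induction h with
  | nil k => intro k' _; exact .nil k'
  | cons ε U e k _ ih => intro k' hk; exact .cons ε U e k' (ih k' hk)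
  | band x P Q e e' f c k l hc hP hQ ihP ihQ =>
    intro k' hk
    have := Der.band x P Q e e' f c k (k' - (k + c)) hc hP (ihQ _ (by omega))
    rwa [show k + c + (k' - (k + c)) = k' by omega] at this

theorem Der.cast {U U' : Word m} {e e' : ℤ} {k k' : ℕ} (h : Der n1 n2 U e k)
    (hU : U = U') (he : e = e') (hk : k ≤ k') : Der n1 n2 U' e' k' := by
  subst hU he; exact h.mono k' hk

theorem Der.append {U : Word m} {e : ℤ} {k : ℕ} (h : Der n1 n2 U e k)
    {V : Word m} {f : ℤ} {l : ℕ} (h' : Der n1 n2 V f l) : Der n1 n2 (U ++ V) (e + f) (k + l) := by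
  induction h with
  | nil k => exact h'.cast rfl (by ring) (by omega)
  | cons ε U e k _ ih => exact (Der.cons ε _ _ _ ih).cast rfl (by ring) le_rfl
  | band x P Q e e' f' c k l' hc hP hQ ihP ihQ =>
    exact (Der.band x P _ e e' _ c k _ hc hP ihQ).cast (by simp) (by ring) (by omega)

theorem Der.nil_inv {e : ℤ} {k : ℕ} (h : Der n1 n2 ([] : Word m) e k) : e = 0 := by
  cases h; rfl

theorem Der.cons0_inv {ε : Bool} {V : Word m} {e : ℤ} {k : ℕ}
    (h : Der n1 n2 ((0, ε) :: V) e k) : Der n1 n2 V (e - sgn ε) k := by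
  generalize hW : ((0, ε) :: V : Word m) = W at h
  cases h with
  | nil => simp at hW
  | cons ε' U e k h =>
    simp only [List.cons.injEq, Prod.mk.injEq, true_and] at hW
    obtain ⟨rfl, rfl⟩ := hW
    exact h.cast rfl (by ring) le_rfl
  | band x P Q e e' f c k l hc hP hQ =>
    simp only [List.cons.injEq] at hW
    exact absurd (by rw [← hW.1]) hc.1

theorem Der.cons_inv {x : Fin (m + 2) × Bool} (hx : x.1 ≠ 0) {V : Word m} {e : ℤ} {k : ℕ}
    (h : Der n1 n2 (x :: V) e k) : ∃ P Q e1 e2 f c k1 k2, V = P ++ linv x :: Q ∧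
      Conv n1 n2 x e1 e2 c ∧ Der n1 n2 P e1 k1 ∧ Der n1 n2 Q f k2 ∧ e = e2 + f ∧
      k = k1 + c + k2 := by
  generalize hW : (x :: V : Word m) = W at h
  cases h with
  | nil => simp at hW
  | cons ε' U e k h =>
    simp only [List.cons.injEq] at hW
    exact absurd (by rw [hW.1]) hx
  | band x' P Q e e' f c k l hc hP hQ =>
    simp only [List.cons.injEq] at hW
    obtain ⟨rfl, rfl⟩ := hW
    exact ⟨P, Q, e, e', f, c, k, l, rfl, hc, hP, hQ, rfl, rfl⟩

theorem Der.snoc_inv {W : Word m} {e : ℤ} {k : ℕ}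
    (h : Der n1 n2 W e k) : ∀ (U : Word m) (x : Fin (m + 2) × Bool), x.1 ≠ 0 → W = U ++ [x] →
     ∃ A B a b b' c k1 k2, U = A ++ linv x :: B ∧
      Conv n1 n2 (linv x) b b' c ∧ Der n1 n2 A a k1 ∧ Der n1 n2 B b k2 ∧ e = a + b' ∧
      k1 + c + k2 ≤ k := by
  induction h with
  | nil k => intro U x _ h; simp at h
  | cons ε U e k h ih =>
    intro U' x hx hW
    rcases U' with _ | ⟨y, U'⟩
    · simp only [List.nil_append, List.cons.injEq] at hW
      exact absurd (by rw [← hW.1]) hx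
    · simp only [List.cons_append, List.cons.injEq] at hW
      obtain ⟨rfl, hW⟩ := hW
      obtain ⟨A, B, a, b, b', c, k1, k2, rfl, hc, hA, hB, rfl, hk⟩ := ih U' x hx hW
      exact ⟨_, B, _, b, b', c, k1, k2, by simp, hc, Der.cons ε A a k1 hA, hB, by ring, hk⟩
  | band y P Q e e' f c k l hc hP hQ ihP ihQ =>
    intro U' x hx hW
    rcases List.eq_nil_or_concat Q with rfl | ⟨Q', z, rfl⟩
    · have hf := hQ.nil_inv
      have hW' : (y :: P) ++ [linv y] = U' ++ [x] := by simpa using hW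
      obtain ⟨rfl, hz⟩ := List.append_inj' hW' rfl
      obtain rfl : linv y = x := by simpa using hz
      exact ⟨[], P, 0, e, e', c, 0, k, by simp, by simpa using hc, .nil 0, hP, by rw [hf]; ring,
        by omega⟩
    · have hW' : (y :: (P ++ linv y :: Q')) ++ [z] = U' ++ [x] := by simpa using hW
      obtain ⟨rfl, hz⟩ := List.append_inj' hW' rfl
      obtain rfl : z = x := by simpa using hz
      obtain ⟨A, B, a, b, b', c', k1, k2, rfl, hc', hA, hB, rfl, hk⟩ := ihQ Q' z hx (by simp)
      exact ⟨_, B, _, b, b', c', _, k2, by simp, hc', Der.band y P A _ _ _ _ _ _ hc hP hA, hB,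
        by ring, by omega⟩

theorem Der.cancel_cons {V : Word m} {e : ℤ} {k : ℕ}
    (h : Der n1 n2 V e k) (x : Fin (m + 2) × Bool) : Der n1 n2 (x :: linv x :: V) e k := by
  by_cases hx : x.1 = 0
  · obtain ⟨i, ε⟩ := x
    obtain rfl : i = 0 := hx
    refine (Der.cons ε _ _ _ (Der.cons (!ε) _ _ _ h)).cast rfl ?_ le_rfl
    cases ε <;> simp [sgn]
  · exact (Der.band x [] V 0 0 e 0 0 k (Conv.zero hx) (.nil 0) h).cast rfl (by ring) (by omega)

theorem Der.insert {W : Word m} {e : ℤ} {k : ℕ} (h : Der n1 n2 W e k) :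
    ∀ (U V : Word m) (x : Fin (m + 2) × Bool), W = U ++ V →
      Der n1 n2 (U ++ x :: linv x :: V) e k := by
  induction h with
  | nil k =>
    intro U V x hW
    obtain ⟨rfl, rfl⟩ := List.append_eq_nil_iff.1 hW.symm
    exact (Der.nil k).cancel_cons x
  | cons ε U e k h ih =>
    intro U' V x hW
    rcases U' with _ | ⟨y, U'⟩
    · obtain rfl : _ = V := hW
      exact (Der.cons ε U e k h).cancel_cons x
    · simp only [List.cons_append, List.cons.injEq] at hW
      obtain ⟨rfl, hW⟩ := hW
      exact Der.cons ε _ e k (ih U' V x hW)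
  | band y P Q e e' f c k l hc hP hQ ihP ihQ =>
    intro U' V x hW
    rcases U' with _ | ⟨y', U'⟩
    · obtain rfl : _ = V := hW
      exact (Der.band y P Q e e' f c k l hc hP hQ).cancel_cons x
    · simp only [List.cons_append, List.cons.injEq] at hW
      obtain ⟨rfl, hW⟩ := hW
      rcases List.append_eq_append_iff.1 hW with ⟨A, rfl, hA⟩ | ⟨A, rfl, rfl⟩
      · rcases A with _ | ⟨z, A⟩
        · simp only [List.nil_append] at hA
          subst hA
          exact (Der.band y _ Q e e' f c k l hc (ihP P [] x (by simp)) hQ).cast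
            (by simp) rfl le_rfl
        · simp only [List.cons_append, List.cons.injEq] at hA
          obtain ⟨rfl, rfl⟩ := hA
          exact (Der.band y P _ e e' f c k l hc hP (ihQ A V x rfl)).cast
            (by simp) rfl le_rfl
      · exact (Der.band y _ Q e e' f c k l hc (ihP U' A x rfl) hQ).cast
            (by simp) rfl le_rfl

theorem Der.delete (hn1 : n1 ≠ 0) (hn2 : n2 ≠ 0) {W : Word m} {e : ℤ} {k : ℕ}
    (h : Der n1 n2 W e k) :
    ∀ (U V : Word m) (x : Fin (m + 2) × Bool), W = U ++ x :: linv x :: V →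
      Der n1 n2 (U ++ V) e k := by
  induction h with
  | nil k => intro U V x hW; simp at hW
  | cons ε U e k h ih =>
    intro U' V x hW
    rcases U' with _ | ⟨y, U'⟩
    · simp only [List.nil_append, List.cons.injEq] at hW
      obtain ⟨rfl, rfl⟩ := hW
      refine (Der.cons0_inv h).cast rfl ?_ le_rfl
      cases ε <;> simp [sgn] <;> ring
    · simp only [List.cons_append, List.cons.injEq] at hW
      obtain ⟨rfl, hW⟩ := hW
      exact Der.cons ε _ e k (ih U' V x hW)
  | band y P Q e e' f c k l hc hP hQ ihP ihQ =>
    intro U' V x hW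
    have hy := hc.1
    rcases U' with _ | ⟨y', U'⟩
    · simp only [List.nil_append, List.cons.injEq] at hW
      obtain ⟨rfl, hW⟩ := hW
      rcases P with _ | ⟨z, P⟩
      · simp only [List.nil_append, List.cons.injEq, true_and] at hW
        subst hW
        have := hP.nil_inv
        subst this
        have := hc.of_zero hn1 hn2
        subst this
        exact hQ.cast rfl (by ring) (by omega)
      · simp only [List.cons_append, List.cons.injEq] at hW
        obtain ⟨rfl, rfl⟩ := hW
        obtain ⟨P1, P2, e1, e2, f', c', k1, k2, rfl, hc', h1, h2, rfl, rfl⟩ :=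
          hP.cons_inv (x := linv y) hy
        have hc'' := hc'.symm
        rw [linv_linv] at hc''
        obtain ⟨d, hd, hdc⟩ := hc.sub hc''
        rw [add_sub_cancel_left] at hdc
        exact (h1.append (Der.band y P2 Q _ _ f d _ _ hdc h2 hQ)).cast (by simp) (by ring)
          (by omega)
    · simp only [List.cons_append, List.cons.injEq] at hW
      obtain ⟨rfl, hW⟩ := hW
      have key : linv y :: Q = x :: linv x :: V → Der n1 n2 (y :: P ++ V) (e' + f) (k + c + l) := by
        intro hA
        simp only [List.cons.injEq] at hA
        obtain ⟨rfl, rfl⟩ := hA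
        rw [linv_linv] at hQ
        obtain ⟨C, D, e1, e2, f', c', k1, k2, rfl, hc', h1, h2, rfl, rfl⟩ := hQ.cons_inv hy
        obtain ⟨d, hd, hdc⟩ := hc.add hc'
        exact (Der.band y _ D _ _ _ d _ _ hdc (hP.append h1) h2).cast (by simp) (by ring)
          (by omega)
      rcases List.append_eq_append_iff.1 hW with ⟨A, rfl, hA⟩ | ⟨A, rfl, hA⟩
      · rcases A with _ | ⟨z, A⟩
        · simpa using key hA
        · simp only [List.cons_append, List.cons.injEq] at hA
          obtain ⟨rfl, rfl⟩ := hA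
          exact (Der.band y P _ e e' f c k l hc hP (ihQ A V x rfl)).cast
            (by simp) rfl le_rfl
      · rcases A with _ | ⟨z, _ | ⟨z', A⟩⟩
        · simpa using key hA.symm
        · simp only [List.cons_append, List.nil_append, List.cons.injEq] at hA
          obtain ⟨rfl, hxy, rfl⟩ := hA
          obtain rfl : x = y := by rw [← linv_linv x, hxy, linv_linv]
          obtain ⟨A, B, a, b, b', c', k1, k2, rfl, hc', h1, h2, rfl, hk⟩ :=
            hP.snoc_inv U' x hy rfl
          have hc'' := hc'.symm
          rw [linv_linv] at hc''
          obtain ⟨d, hd, hdc⟩ := hc.sub hc''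
          rw [add_sub_cancel_right] at hdc
          exact (Der.band x A _ _ _ _ d _ _ hdc h1 (h2.append hQ)).cast (by simp) (by ring)
            (by omega)
        · simp only [List.cons_append, List.cons.injEq] at hA
          obtain ⟨rfl, rfl, rfl⟩ := hA
          exact (Der.band y _ Q e e' f c k l hc (ihP U' A x rfl) hQ).cast
            (by simp) rfl le_rfl

theorem Der.conj {U : Word m} {k : ℕ} (h : Der n1 n2 U 0 k) (x : Fin (m + 2) × Bool) :
    Der n1 n2 (x :: (U ++ [linv x])) 0 k := by
  by_cases hx : x.1 = 0
  · obtain ⟨i, ε⟩ := x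
    obtain rfl : i = 0 := hx
    refine (Der.cons ε _ _ _ (h.append (Der.cons (!ε) _ _ _ (Der.nil 0)))).cast rfl ?_ le_rfl
    cases ε <;> simp [sgn]
  · exact (Der.band x U [] 0 0 0 0 k 0 (Conv.zero hx) h (.nil 0)).cast rfl (by ring) (by omega)

theorem Der.conj_word {U : Word m} {k : ℕ} (h : Der n1 n2 U 0 k) (S : Word m) :
    Der n1 n2 (S ++ U ++ FreeGroup.invRev S) 0 k := by
  induction S with
  | nil => simpa using h
  | cons x S ih =>
    exact (ih.conj x).cast (by simp [FreeGroup.invRev, linv]) rfl le_rfl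

theorem Der.of_mk_eq (hn1 : n1 ≠ 0) (hn2 : n2 ≠ 0) {U V : Word m} {e : ℤ} {k : ℕ}
    (h : Der n1 n2 U e k) (hUV : FreeGroup.mk U = FreeGroup.mk V) : Der n1 n2 V e k := by
  obtain ⟨Z, hU, hV⟩ := FreeGroup.Red.exact.1 hUV
  have hZ : Der n1 n2 Z e k := by
    clear hV
    induction hU with
    | refl => exact h
    | tail _ hs ih =>
      cases hs with
      | not => exact ih.delete hn1 hn2 _ _ _ rfl
  clear hU hUV
  induction hV using Relation.ReflTransGen.head_induction_on with
  | refl => exact hZ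
  | head hs _ ih =>
    cases hs with
    | not => exact ih.insert _ _ _ rfl

theorem Der.pow (ε : Bool) (n : ℕ) :
    Der n1 n2 (List.replicate n ((0 : Fin (m + 2)), ε)) (n * sgn ε) 0 := by
  induction n with
  | zero => exact (Der.nil 0).cast rfl (by simp) le_rfl
  | succ n ih => exact (Der.cons ε _ _ _ ih).cast rfl (by push_cast; ring) le_rfl

theorem exists_pow_word (z : ℤ) :
    ∃ w : Word m, FreeGroup.mk w = FreeGroup.of (0 : Fin (m + 2)) ^ z ∧ Der n1 n2 w z 0 := by
  have key (ε : Bool) (n : ℕ) : FreeGroup.mk (List.replicate n ((0 : Fin (m + 2)), ε)) =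
      FreeGroup.of (0 : Fin (m + 2)) ^ (n * sgn ε : ℤ) := by
    have h1 : FreeGroup.mk [((0 : Fin (m + 2)), ε)] = FreeGroup.of (0 : Fin (m + 2)) ^ sgn ε := by
      cases ε <;> simp [sgn, FreeGroup.of, FreeGroup.invRev]
    induction n with
    | zero => simp [FreeGroup.one_eq_mk]
    | succ n ih =>
      rw [List.replicate_succ, ← List.singleton_append, ← FreeGroup.mul_mk, ih, h1, ← zpow_add]
      push_cast; ring_nf
  rcases Int.eq_nat_or_neg z with ⟨n, rfl | rfl⟩
  · exact ⟨_, by rw [key true n]; simp [sgn], (Der.pow true n).cast rfl (by simp [sgn]) le_rfl⟩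
  · exact ⟨_, by rw [key false n]; simp [sgn], (Der.pow false n).cast rfl (by simp [sgn]) le_rfl⟩

/-- The relator and its inverse have derivations of cost one. -/
theorem exists_rel_word (g : FreeGroup (Fin (m + 2)))
    (hg : g ∈ ({relBS m n1 n2} : Set _) ∨ g⁻¹ ∈ ({relBS m n1 n2} : Set _)) :
    ∃ w : Word m, FreeGroup.mk w = g ∧ Der n1 n2 w 0 1 := by
  have hc (ε : Bool) (z : ℤ) (hz : z.natAbs = 1) : Conv n1 n2 ((1 : Fin (m + 2)), ε)
    ((if ε then n1 else n2) * z) ((if ε then n2 else n1) * z) 1 :=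
    ⟨by simp, z, by simp, rfl, rfl, hz.symm⟩
  obtain ⟨u1, hu1, du1⟩ := exists_pow_word (m := m) (n1 := n1) (n2 := n2) n1
  obtain ⟨u2, hu2, du2⟩ := exists_pow_word (m := m) (n1 := n1) (n2 := n2) (-n2)
  obtain ⟨v1, hv1, dv1⟩ := exists_pow_word (m := m) (n1 := n1) (n2 := n2) (-n1)
  obtain ⟨v2, hv2, dv2⟩ := exists_pow_word (m := m) (n1 := n1) (n2 := n2) n2
  have hof : FreeGroup.mk [((1 : Fin (m + 2)), true)] = FreeGroup.of 1 := rfl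
  have hof' : FreeGroup.mk [((1 : Fin (m + 2)), false)] = (FreeGroup.of 1)⁻¹ := by
    simp [FreeGroup.of, FreeGroup.invRev]
  rcases hg with hg | hg
  · rw [Set.mem_singleton_iff] at hg
    refine ⟨((1, true) :: (u1 ++ (1, false) :: u2)), ?_, ?_⟩
    · rw [hg, relBS, ← hu1, ← hu2, ← hof', ← hof]
      simp [FreeGroup.mul_mk]
    · exact (Der.band (1, true) u1 u2 _ _ _ 1 0 0 (hc true 1 rfl)
        (du1.cast rfl (by simp) le_rfl) du2).cast rfl (by simp) le_rfl
  · rw [Set.mem_singleton_iff] at hg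
    have hg' : g = FreeGroup.of 0 ^ n2 * FreeGroup.of 1 * FreeGroup.of 0 ^ (-n1) *
        (FreeGroup.of 1)⁻¹ := by
      rw [← inv_inv g, hg, relBS]; group
    refine ⟨v2 ++ ((1, true) :: (v1 ++ (1, false) :: [])), ?_, ?_⟩
    · rw [hg', ← hv1, ← hv2, ← hof', ← hof]
      simp [FreeGroup.mul_mk]
    · exact (dv2.append (Der.band (1, true) v1 [] _ _ _ 1 0 0 (hc true (-1) rfl)
        (dv1.cast rfl (by simp) le_rfl) (.nil 0))).cast rfl (by simp) le_rfl

theorem der_of_isProdConj (hn1 : n1 ≠ 0) (hn2 : n2 ≠ 0) {k : ℕ} {W : Word m}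
    (h : IsProdConj {relBS m n1 n2} k (evalW W)) : Der n1 n2 W 0 k := by
  obtain ⟨r, s, hr, hW⟩ := h
  suffices H : ∃ w : Word m, FreeGroup.mk w = (List.ofFn fun i => s i * r i * (s i)⁻¹).prod ∧
      Der n1 n2 w 0 k by
    obtain ⟨w, hw, hd⟩ := H
    exact hd.of_mk_eq hn1 hn2 (hw.trans hW.symm)
  clear hW
  induction k with
  | zero => exact ⟨[], by simp [FreeGroup.one_eq_mk], .nil 0⟩
  | succ k ih =>
    obtain ⟨w, hw, hd⟩ := ih (fun i => r i.succ) (fun i => s i.succ) (fun i => hr i.succ)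
    obtain ⟨u, hu, hud⟩ := exists_rel_word (r 0) (hr 0)
    refine ⟨((s 0).toWord ++ u ++ FreeGroup.invRev (s 0).toWord) ++ w, ?_, ?_⟩
    · rw [List.ofFn_succ, List.prod_cons, ← hw, ← FreeGroup.mul_mk, ← FreeGroup.mul_mk,
        ← FreeGroup.mul_mk, ← FreeGroup.inv_mk, FreeGroup.mk_toWord, hu]
    · exact ((hud.conj_word _).append hd).cast rfl (by ring) (by omega)
end

/-! ### From operations to products of conjugates -/

/-- Inductive version of `IsProdConj`. -/
inductive PC {G : Type*} [Group G] (R : Set G) : ℕ → G → Prop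
  | one : PC R 0 1
  | cons (r s : G) (k : ℕ) (g : G) (hr : r ∈ R ∨ r⁻¹ ∈ R) (h : PC R k g) :
      PC R (k + 1) (s * r * s⁻¹ * g)

section
variable {G : Type*} [Group G] {R : Set G}

theorem PC.isProdConj {k : ℕ} {g : G} (h : PC R k g) : IsProdConj R k g := by
  induction h with
  | one => exact ⟨fun _ => 1, fun _ => 1, fun i => i.elim0, by simp⟩
  | cons r s k g hr _ ih =>
    obtain ⟨r', s', h1, rfl⟩ := ih
    refine ⟨Fin.cons r r', Fin.cons s s', ?_, ?_⟩
    · intro i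
      refine Fin.cases ?_ ?_ i
      · simpa using hr
      · intro i; simpa using h1 i
    · rw [List.ofFn_succ]; simp

theorem PC.mul {k l : ℕ} {g h : G} (hg : PC R k g) (hh : PC R l h) : PC R (k + l) (g * h) := by
  induction hg with
  | one => simpa using hh
  | cons r s k g hr _ ih =>
    have := PC.cons r s _ _ hr ih
    rw [mul_assoc (s * r * s⁻¹)]
    rwa [show k + 1 + l = k + l + 1 by omega]

theorem PC.conj {k : ℕ} {g : G} (hg : PC R k g) (t : G) : PC R k (t * g * t⁻¹) := by
  induction hg with
  | one => simpa using PC.one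
  | cons r s k g hr _ ih =>
    have := PC.cons r (t * s) _ _ hr ih
    convert this using 1
    group

theorem PC.single {r : G} (hr : r ∈ R ∨ r⁻¹ ∈ R) : PC R 1 r := by
  simpa using PC.cons r 1 _ _ hr PC.one

theorem PC.inv {k : ℕ} {g : G} (hg : PC R k g) : PC R k g⁻¹ := by
  induction hg with
  | one => simpa using PC.one
  | cons r s k g hr _ ih =>
    have h1 : PC R 1 r⁻¹ := PC.single (by rw [inv_inv]; exact hr.symm)
    have := ih.mul (h1.conj s)
    convert this using 1
    group

theorem PC.zpow {r : G} (hr : r ∈ R) (h : G) (q : ℤ) : PC R q.natAbs ((r * h) ^ q * h ^ (-q)) := by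
  have key (n : ℕ) : PC R n ((r * h) ^ n * (h ^ n)⁻¹) := by
    induction n with
    | zero => simpa using PC.one
    | succ n ih =>
      have := ih.mul ((PC.single (Or.inl hr)).conj (h ^ n))
      convert this using 1
      rw [pow_succ, pow_succ]; group
  rcases Int.eq_nat_or_neg q with ⟨n, rfl | rfl⟩
  · simpa using key n
  · have := ((key n).inv).conj ((r * h) ^ n)⁻¹
    simp only [Int.natAbs_neg, Int.natAbs_natCast]
    convert this using 1
    simp [mul_assoc]

variable {m : ℕ} {n1 n2 : ℤ} {W : Word m}

/-- Image of a prefix of `W`. -/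
def pre (W : Word m) (i : ℕ) : FreeGroup (Fin (m + 2)) := FreeGroup.mk (W.take i)

theorem pre_succ {i : ℕ} {x : Fin (m + 2) × Bool} (h : W[i]? = some x) :
    pre W (i + 1) = pre W i * FreeGroup.mk [x] := by
  rw [pre, pre, FreeGroup.mul_mk, List.take_add_one, h]; rfl

theorem pre_pred {i : ℕ} {x : Fin (m + 2) × Bool} (hi : 1 ≤ i) (h : W[i - 1]? = some x) :
    pre W i = pre W (i - 1) * FreeGroup.mk [x] := by
  rw [← pre_succ h]; congr 1; omega

theorem mk_a1 (ε : Bool) :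
    FreeGroup.mk [((0 : Fin (m + 2)), ε)] = FreeGroup.of (0 : Fin (m + 2)) ^ sgn ε := by
  cases ε <;> simp [sgn, FreeGroup.of, FreeGroup.invRev]

theorem mk_inv_letter (i : Fin (m + 2)) (ε : Bool) :
    FreeGroup.mk [(i, !ε)] = (FreeGroup.mk [(i, ε)])⁻¹ := by
  simp [FreeGroup.invRev]

/-- Meaning of a pseudobracket. -/
def Sem (n1 n2 : ℤ) (W : Word m) (b : PB) : Prop :=
  PC {relBS m n1 n2} b.c4 ((pre W b.c1)⁻¹ * pre W b.c2 * FreeGroup.of 0 ^ (-b.c3))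

theorem sem_step (hn1 : n1 ≠ 0) (hn2 : n2 ≠ 0) {B C : Finset PB} (h : Step m n1 n2 W B C)
    (hB : ∀ b ∈ B, Sem n1 n2 W b) : ∀ b ∈ C, Sem n1 n2 W b := by
  have hX (q : ℤ) : PC {relBS m n1 n2} q.natAbs
      (FreeGroup.of 1 * FreeGroup.of 0 ^ (n1 * q) * (FreeGroup.of 1)⁻¹ *
        FreeGroup.of 0 ^ (-(n2 * q))) := by
    have := PC.zpow (R := {relBS m n1 n2}) rfl (FreeGroup.of 0 ^ n2) q
    convert this using 1
    have : relBS m n1 n2 * FreeGroup.of 0 ^ n2 =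
      FreeGroup.of 1 * FreeGroup.of 0 ^ n1 * (FreeGroup.of 1)⁻¹ := by
      rw [relBS]; group
    rw [this, conj_zpow, ← zpow_mul, ← zpow_mul, mul_neg]
  have h1t : FreeGroup.mk [((1 : Fin (m + 2)), true)] = FreeGroup.of 1 := rfl
  have h1f : FreeGroup.mk [((1 : Fin (m + 2)), false)] = (FreeGroup.of 1)⁻¹ :=
    mk_inv_letter 1 true
  cases h with
  | add v hv hnot hpbs =>
    intro b hb
    rcases Finset.mem_insert.1 hb with rfl | hb
    · simpa [Sem] using PC.one
    · exact hB b hb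
  | ext1L b b' hb ε hl hlet hb' hpbs =>
    intro c hc
    rcases Finset.mem_insert.1 hc with rfl | hc
    · have := PC.conj (hB b hb) (FreeGroup.of 0 ^ sgn ε)
      subst hb'
      unfold Sem
      convert this using 1
      rw [pre_pred hl hlet, mk_a1]
      dsimp only
      group
    · exact hB c (Finset.mem_of_mem_erase hc)
  | ext1R b b' hb ε hlet hb' hpbs =>
    intro c hc
    rcases Finset.mem_insert.1 hc with rfl | hc
    · have := hB b hb
      subst hb'
      unfold Sem at *
      convert this using 1
      dsimp only
      rw [pre_succ hlet, mk_a1]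
      group
    · exact hB c (Finset.mem_of_mem_erase hc)
  | ext2pos b b' hb hl hlet1 hlet2 hs hdvd hb' hpbs =>
    intro c hc
    rcases Finset.mem_insert.1 hc with rfl | hc
    · obtain ⟨q, hq⟩ := hdvd
      have := (PC.conj (hB b hb) (FreeGroup.of 1)).mul (hX q)
      have hq' : b.c3 / n1 = q := by rw [hq, Int.mul_ediv_cancel_left _ hn1]
      subst hb'
      unfold Sem
      dsimp only
      rw [hq']
      convert this using 1
      rw [pre_pred hl hlet1, pre_succ hlet2, h1t, h1f, hq]
      group
    · exact hB c (Finset.mem_of_mem_erase hc)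
  | ext2neg b b' hb hl hlet1 hlet2 hs hdvd hb' hpbs =>
    intro c hc
    rcases Finset.mem_insert.1 hc with rfl | hc
    · obtain ⟨q, hq⟩ := hdvd
      have := (PC.conj (hB b hb) (FreeGroup.of 1)⁻¹).mul ((hX q).inv.conj (FreeGroup.of 1)⁻¹)
      have hq' : b.c3 / n2 = q := by rw [hq, Int.mul_ediv_cancel_left _ hn2]
      subst hb'
      unfold Sem
      dsimp only
      rw [hq']
      convert this using 1
      rw [pre_pred hl hlet1, pre_succ hlet2, h1t, h1f, hq]
      group
    · exact hB c (Finset.mem_of_mem_erase hc)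
  | ext3 b b' hb hs i ε hi hl hlet1 hlet2 hb' hpbs =>
    intro c hc
    rcases Finset.mem_insert.1 hc with rfl | hc
    · have := PC.conj (hB b hb) (FreeGroup.mk [(i, ε)])
      subst hb'
      unfold Sem
      convert this using 1
      dsimp only
      rw [pre_pred hl hlet1, pre_succ hlet2, mk_inv_letter, hs]
      group
    · exact hB c (Finset.mem_of_mem_erase hc)
  | merge b c b' hb hc hbc hr hb' hpbs =>
    intro d hd
    rcases Finset.mem_insert.1 hd with rfl | hd
    · have := (hB b hb).mul (PC.conj (hB c hc) (FreeGroup.of 0 ^ b.c3))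
      subst hb'
      unfold Sem
      convert this using 1
      dsimp only
      rw [hr]
      group
    · exact hB d (Finset.mem_of_mem_erase (Finset.mem_of_mem_erase hd))

end

/-! ### Scheduling a derivation -/

/-- Bounded reachability by elementary operations, all systems satisfying `Q`. -/
inductive Reach {m : ℕ} (n1 n2 : ℤ) (W : Word m) (Q : Finset PB → Prop) :
    ℕ → Finset PB → Finset PB → Prop
  | refl (B : Finset PB) (h : Q B) : Reach n1 n2 W Q 0 B B
  | tail (t : ℕ) (B C D : Finset PB) (h : Reach n1 n2 W Q t B C) (hs : Step m n1 n2 W C D)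
      (hD : Q D) : Reach n1 n2 W Q (t + 1) B D

/-- The invariant of the systems occurring in the schedule. -/
def QQ (K : ℕ) (Bd : ℤ) (B : Finset PB) : Prop := B.card ≤ K ∧ ∀ b ∈ B, 2 * |b.c3| ≤ Bd

/-- `B` consists of nonempty disjoint pseudobrackets not meeting `(i, j)`. -/
def Good {m : ℕ} (W : Word m) (B : Finset PB) (i j : ℕ) : Prop :=
  (∀ c ∈ B, c.c1 < c.c2 ∧ c.c2 ≤ W.length ∧ (c.c2 ≤ i ∨ j ≤ c.c1)) ∧
    ∀ b ∈ B, ∀ c ∈ B, b ≠ c → b.c2 ≤ c.c1 ∨ c.c2 ≤ b.c1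

section
variable {m : ℕ} {n1 n2 : ℤ} {W : Word m}

theorem Reach.trans {Q : Finset PB → Prop} {s t : ℕ} {B C D : Finset PB}
    (h : Reach n1 n2 W Q s B C) (h' : Reach n1 n2 W Q t C D) : Reach n1 n2 W Q (s + t) B D := by
  induction h' with
  | refl => exact h
  | tail t _ _ _ _ hs hD ih => exact .tail _ _ _ _ (ih h) hs hD

theorem Reach.seq {Q : Finset PB → Prop} {t : ℕ} {B C : Finset PB}
    (h : Reach n1 n2 W Q t B C) : ∃ Bs : ℕ → Finset PB, Bs 0 = B ∧ Bs t = C ∧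
      (∀ i < t, Step m n1 n2 W (Bs i) (Bs (i + 1))) ∧ ∀ i ≤ t, Q (Bs i) := by
  induction h with
  | refl B h => exact ⟨fun _ => B, rfl, rfl, by simp, fun _ _ => h⟩
  | tail t B C D _ hs hD ih =>
    obtain ⟨Bs, h0, ht, h1, h2⟩ := ih
    refine ⟨fun i => if i ≤ t then Bs i else D, by simp [h0], by simp, ?_, ?_⟩
    · intro i hi
      rcases Nat.lt_or_ge i t with h | h
      · simpa [h.le, h] using h1 i h
      · obtain rfl : i = t := by omega
        simpa [ht] using hs
    · intro i hi
      dsimp only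
      split_ifs with h
      · exact h2 i h
      · exact hD

theorem Good.mono {B : Finset PB} {i j i' j' : ℕ} (h : Good W B i j) (hi : i ≤ i') (hj : j' ≤ j) :
    Good W B i' j' := by
  refine ⟨fun c hc => ?_, h.2⟩
  have := h.1 c hc
  omega

theorem Good.notMem {B : Finset PB} {i j : ℕ} (h : Good W B i j) {b : PB}
    (h1 : i ≤ b.c1) (h3 : b.c2 ≤ j) : b ∉ B := by
  intro hb
  have := h.1 b hb
  omega

theorem Good.isPBS {B : Finset PB} {i j : ℕ} (h : Good W B i j) (hj : j ≤ W.length) {b : PB}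
    (h1 : i ≤ b.c1) (h2 : b.c1 ≤ b.c2) (h3 : b.c2 ≤ j) : IsPBS W (insert b B) := by
  constructor
  · intro c hc
    rcases Finset.mem_insert.1 hc with rfl | hc
    · exact ⟨h2, h3.trans hj⟩
    · have := h.1 c hc
      exact ⟨this.1.le, this.2.1⟩
  · intro c hc d hd hcd
    rcases Finset.mem_insert.1 hc with hc1 | hc1 <;> rcases Finset.mem_insert.1 hd with hd1 | hd1
    · exact absurd (hc1.trans hd1.symm) hcd
    · have := h.1 d hd1
      subst hc1
      omega
    · have := h.1 c hc1
      subst hd1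
      omega
    · exact h.2 c hc1 d hd1 hcd

theorem Good.insert {B : Finset PB} {i j i' j' : ℕ} (h : Good W B i j) (hj : j ≤ W.length) {b : PB}
    (h1 : i ≤ b.c1) (h2 : b.c1 < b.c2) (h3 : b.c2 ≤ j) (hi' : i ≤ i') (hj' : j' ≤ j)
    (hb : b.c2 ≤ i' ∨ j' ≤ b.c1) : Good W (insert b B) i' j' := by
  refine ⟨?_, (h.isPBS hj h1 h2.le h3).2⟩
  intro c hc
  rcases Finset.mem_insert.1 hc with rfl | hc
  · omega
  · have := h.1 c hc
    omega

theorem QQ.insert {B : Finset PB} {K : ℕ} {Bd : ℤ} (hK : B.card + 1 ≤ K)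
    (hB : ∀ b ∈ B, 2 * |b.c3| ≤ Bd) {b : PB} (hb : 2 * |b.c3| ≤ Bd) : QQ K Bd (insert b B) := by
  refine ⟨(Finset.card_insert_le _ _).trans hK, ?_⟩
  intro c hc
  rcases Finset.mem_insert.1 hc with rfl | hc
  · exact hb
  · exact hB c hc

theorem Conv.bound {x : Fin (m + 2) × Bool} {e e' : ℤ} {c : ℕ} (h : Conv n1 n2 x e e' c) :
    |e| + |e'| = (|n1| + |n2|) * c := by
  obtain ⟨_, q, _, rfl, rfl, rfl⟩ := h
  rw [Int.natCast_natAbs, abs_mul, abs_mul]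
  split_ifs <;> ring

theorem countA1_append (U V : Word m) : countA1 (U ++ V) = countA1 U + countA1 V := by
  simp [countA1]

theorem noA1_append (U V : Word m) : noA1 (U ++ V) = noA1 U + noA1 V := by
  simp [noA1]

theorem countA1_cons0 (ε : Bool) (V : Word m) : countA1 ((0, ε) :: V) = countA1 V + 1 := by
  simp [countA1]

theorem noA1_cons0 (ε : Bool) (V : Word m) : noA1 ((0, ε) :: V) = noA1 V := by
  simp [noA1]

theorem countA1_cons {x : Fin (m + 2) × Bool} (hx : x.1 ≠ 0) (V : Word m) :
    countA1 (x :: V) = countA1 V := by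
  simp [countA1, hx]

theorem noA1_cons {x : Fin (m + 2) × Bool} (hx : x.1 ≠ 0) (V : Word m) :
    noA1 (x :: V) = noA1 V + 1 := by
  simp [noA1, hx]

theorem abs_sgn (ε : Bool) : |sgn ε| = 1 := by cases ε <;> simp [sgn]

theorem Der.bound {U : Word m} {e : ℤ} {k : ℕ} (h : Der n1 n2 U e k) :
    |e| ≤ countA1 U + (|n1| + |n2|) * k := by
  induction h with
  | nil k => simp only [abs_zero]; positivity
  | cons ε U e k h ih =>
    rw [countA1_cons0]
    have := abs_add_le (sgn ε) e
    rw [abs_sgn] at this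
    push_cast; linarith
  | band x P Q e e' f c k l hc hP hQ ihP ihQ =>
    have hb := hc.bound
    have := abs_add_le e' f
    have h0 := abs_nonneg e
    have h1 : 0 ≤ (|n1| + |n2|) * (k : ℤ) := by positivity
    rw [countA1_cons hc.1, countA1_append, countA1_cons (x := linv x) hc.1]
    push_cast
    have h2 : (0 : ℤ) ≤ countA1 P := by positivity
    linarith

/-- The subword `U` of `W` can be bracketed with controlled resources. -/
def Buildable (n1 n2 : ℤ) (W U : Word m) (e : ℤ) (k : ℕ) : Prop :=
  ∀ (P Z : Word m) (B : Finset PB) (K : ℕ) (Bd : ℤ), W = P ++ U ++ Z →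
    Good W B P.length (P.length + U.length) →
    B.card + (1 + Nat.size (noA1 U)) ≤ K →
    (∀ b ∈ B, 2 * |b.c3| ≤ Bd) →
    |e| + countA1 U + (|n1| + |n2|) * k ≤ Bd →
    ∃ t k', t + 1 ≤ 3 * U.length ∧ k' ≤ k ∧
      Reach n1 n2 W (QQ K Bd) t B (insert ⟨P.length, P.length + U.length, e, k'⟩ B)

theorem Buildable.single (ε : Bool) (k : ℕ) :
    Buildable n1 n2 W [(0, ε)] (sgn ε) k := by
  intro P Z B K Bd hW hG hK hB hBd
  have hj : P.length + 1 ≤ W.length := by rw [hW]; simp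
  simp only [List.length_singleton] at hG
  have hBd0 : (2 : ℤ) ≤ Bd := by
    have h1 : 0 ≤ (|n1| + |n2|) * (k : ℤ) := by positivity
    rw [abs_sgn, countA1_cons0] at hBd
    simp [countA1] at hBd
    linarith
  have hn : (⟨P.length, P.length, 0, 0⟩ : PB) ∉ B := hG.notMem (by simp) (by simp)
  refine ⟨2, 0, by simp, Nat.zero_le _, ?_⟩
  refine .tail 1 _ (insert (⟨P.length, P.length, 0, 0⟩ : PB) B) _
    (.tail 0 _ _ _ (.refl _ ⟨by omega, hB⟩) (Step.add B P.length (by omega) hn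
      (hG.isPBS hj (by simp) (by simp) (by simp))) ?_) ?_ ?_
  · exact QQ.insert (by omega) hB (by simp; omega)
  · have := Step.ext1R (n1 := n1) (n2 := n2) (W := W)
      (insert (⟨P.length, P.length, 0, 0⟩ : PB) B) ⟨P.length, P.length, 0, 0⟩
      ⟨P.length, P.length + 1, sgn ε, 0⟩ (by simp) ε (by simp [hW]) (by simp)
      (by rw [Finset.erase_insert hn]
          exact hG.isPBS hj (by simp) (by simp) (by simp))
    rwa [Finset.erase_insert hn] at this
  · exact QQ.insert (by omega) hB (by simp [abs_sgn]; omega)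

theorem Buildable.cons (ε : Bool) {U : Word m} {e : ℤ} {k : ℕ}
    (hd : Der n1 n2 U e k) (h : Buildable n1 n2 W U e k) :
    Buildable n1 n2 W ((0, ε) :: U) (sgn ε + e) k := by
  intro P Z B K Bd hW hG hK hB hBd
  have hj : P.length + (U.length + 1) ≤ W.length := by rw [hW]; simp
  simp only [List.length_cons] at hG ⊢
  have hbd := hd.bound
  have he : |e| ≤ |sgn ε + e| + 1 := by
    have := abs_sub (sgn ε + e) (sgn ε)
    rw [abs_sgn] at this
    simpa using this
  have he' : |sgn ε + e| ≤ 1 + |e| := by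
    have := abs_add_le (sgn ε) e
    rwa [abs_sgn] at this
  rw [countA1_cons0] at hBd
  rw [noA1_cons0] at hK
  push_cast at hBd
  obtain ⟨t, k', ht, hk', hR⟩ := h (P ++ [(0, ε)]) Z B K Bd (by simp [hW])
    (hG.mono (by simp) (by simp; omega)) hK hB (by linarith)
  have hl : (P ++ [((0 : Fin (m + 2)), ε)]).length = P.length + 1 := by simp
  rw [hl] at hR
  have hn : (⟨P.length + 1, P.length + 1 + U.length, e, k'⟩ : PB) ∉ B :=
    hG.notMem (by simp) (by simp; omega)
  refine ⟨t + 1, k', by omega, hk', .tail _ _ _ _ hR ?_ ?_⟩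
  · have := Step.ext1L (n1 := n1) (n2 := n2) (W := W)
      (insert (⟨P.length + 1, P.length + 1 + U.length, e, k'⟩ : PB) B)
      ⟨P.length + 1, P.length + 1 + U.length, e, k'⟩
      ⟨P.length, P.length + (U.length + 1), sgn ε + e, k'⟩ (by simp) ε (by simp) (by simp [hW])
      (by simp; constructor <;> ring)
      (by rw [Finset.erase_insert hn]
          exact hG.isPBS hj (by simp) (by simp) (by simp))
    rwa [Finset.erase_insert hn] at this
  · exact QQ.insert (by omega) hB (by simp only; linarith)

theorem Buildable.band (hn1 : n1 ≠ 0) (hn2 : n2 ≠ 0) {x : Fin (m + 2) × Bool} {U : Word m}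
    {e e' : ℤ} {k c : ℕ} (hc : Conv n1 n2 x e e' c) (hd : Der n1 n2 U e k)
    (h : U ≠ [] → Buildable n1 n2 W U e k) :
    Buildable n1 n2 W (x :: (U ++ [linv x])) e' (k + c) := by
  intro P Z B K Bd hW hG hK hB hBd
  have hl' : (x :: (U ++ [linv x])).length = U.length + 2 := by simp
  have hj : P.length + (U.length + 2) ≤ W.length := by rw [hW]; simp
  rw [hl'] at hG ⊢
  have hbd := hd.bound
  have hcb := hc.bound
  rw [countA1_cons hc.1, countA1_append, countA1_cons (x := linv x) hc.1] at hBd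
  rw [noA1_cons hc.1, noA1_append, noA1_cons (x := linv x) hc.1] at hK
  have hz : countA1 ([] : Word m) = 0 := rfl
  rw [hz] at hBd
  push_cast at hBd
  have hk0 : 0 ≤ (|n1| + |n2|) * (k : ℤ) := by positivity
  have hA0 : (0 : ℤ) ≤ countA1 U := by positivity
  have he0 := abs_nonneg e
  have he0' := abs_nonneg e'
  have hsz : Nat.size (noA1 U) ≤ Nat.size (noA1 U + (noA1 ([] : Word m) + 1) + 1) :=
    Nat.size_le_size (by omega)
  have hlen : (P ++ [x]).length = P.length + 1 := by simp
  -- bracket for `U`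
  obtain ⟨t, k', ht, hk', hR⟩ : ∃ t k', t ≤ 3 * U.length + 1 ∧ k' ≤ k ∧
      Reach n1 n2 W (QQ K Bd) t B (insert ⟨P.length + 1, P.length + 1 + U.length, e, k'⟩ B) := by
    by_cases hU : U = []
    · subst hU
      have := hd.nil_inv
      subst this
      refine ⟨1, 0, by simp, Nat.zero_le _, .tail 0 _ _ _ (.refl _ ⟨by omega, hB⟩)
        (Step.add B (P.length + 1) (by omega) (hG.notMem (by simp) (by simp))
          (hG.isPBS hj (by simp) (by simp) (by simp))) ?_⟩
      exact QQ.insert (by omega) hB (by simp only [abs_zero]; linarith)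
    · obtain ⟨t, k', ht, hk', hR⟩ := h hU (P ++ [x]) (linv x :: Z) B K Bd (by simp [hW])
        (hG.mono (by simp) (by simp; omega)) (by omega) hB (by linarith)
      rw [hlen] at hR
      exact ⟨t, k', by omega, hk', hR⟩
  have hn : (⟨P.length + 1, P.length + 1 + U.length, e, k'⟩ : PB) ∉ B :=
    hG.notMem (by simp) (by simp; omega)
  have hW1 : W[P.length + 1 - 1]? = some x := by simp [hW]
  have hW2 : W[P.length + 1 + U.length]? = some (linv x) := by
    rw [hW, show P ++ x :: (U ++ [linv x]) ++ Z = (P ++ [x] ++ U) ++ linv x :: Z by simp,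
      List.getElem?_append_right (by simp; omega)]
    rw [show P.length + 1 + U.length - (P ++ [x] ++ U).length = 0 by simp; omega]
    rfl
  have hpbs (f : ℤ) (l : ℕ) :
      IsPBS W (insert ⟨P.length, P.length + (U.length + 2), f, l⟩
        ((insert (⟨P.length + 1, P.length + 1 + U.length, e, k'⟩ : PB) B).erase
          ⟨P.length + 1, P.length + 1 + U.length, e, k'⟩)) := by
    rw [Finset.erase_insert hn]
    exact hG.isPBS hj (by simp) (by simp) (by simp)
  have hQ (l : ℕ) : QQ K Bd (insert ⟨P.length, P.length + (U.length + 2), e', l⟩ B) :=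
    QQ.insert (by omega) hB (by simp only; linarith)
  obtain ⟨hx0, q, hq, hqe, hqe', hqc⟩ := hc
  by_cases he : e = 0
  · subst he
    have hcc := Conv.of_zero hn1 hn2 ⟨hx0, q, hq, hqe, hqe', hqc⟩
    subst hcc
    refine ⟨t + 1, k', by omega, by omega, .tail _ _ _ _ hR ?_ (hQ _)⟩
    have := Step.ext3 (n1 := n1) (n2 := n2) (W := W) _
      ⟨P.length + 1, P.length + 1 + U.length, 0, k'⟩
      ⟨P.length, P.length + (U.length + 2), 0, k'⟩ (Finset.mem_insert_self _ B) rfl x.1 x.2 hx0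
      (by simp) hW1 hW2 (by simp; omega) (hpbs _ _)
    rwa [Finset.erase_insert hn] at this
  · have hx1 : x.1 = 1 := by
      by_contra hx1
      rw [hq hx1] at hqe
      simp at hqe
      exact he hqe
    refine ⟨t + 1, k' + c, by omega, by omega, .tail _ _ _ _ hR ?_ (hQ _)⟩
    obtain ⟨i, ε⟩ := x
    obtain rfl : i = 1 := hx1
    cases ε with
    | true =>
      simp only [if_true] at hqe hqe'
      have hdiv : e / n1 = q := by rw [hqe, Int.mul_ediv_cancel_left _ hn1]
      have := Step.ext2pos (n1 := n1) (n2 := n2) (W := W) _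
        ⟨P.length + 1, P.length + 1 + U.length, e, k'⟩
        ⟨P.length, P.length + (U.length + 2), e', k' + c⟩ (Finset.mem_insert_self _ B)
        (by simp) hW1 hW2 he ⟨q, hqe⟩
        (by simp only [hdiv, PB.mk.injEq]; refine ⟨by omega, by omega, by rw [hqe']; ring, by omega⟩)
        (hpbs _ _)
      rwa [Finset.erase_insert hn] at this
    | false =>
      simp only [Bool.false_eq_true, if_false] at hqe hqe'
      have hdiv : e / n2 = q := by rw [hqe, Int.mul_ediv_cancel_left _ hn2]
      have := Step.ext2neg (n1 := n1) (n2 := n2) (W := W) _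
        ⟨P.length + 1, P.length + 1 + U.length, e, k'⟩
        ⟨P.length, P.length + (U.length + 2), e', k' + c⟩ (Finset.mem_insert_self _ B)
        (by simp) hW1 hW2 he ⟨q, hqe⟩
        (by simp only [hdiv, PB.mk.injEq]; refine ⟨by omega, by omega, by rw [hqe']; ring, by omega⟩)
        (hpbs _ _)
      rwa [Finset.erase_insert hn] at this

theorem size_half {a b : ℕ} (h : a ≤ b) (h0 : 0 < a + b) :
    1 + Nat.size a ≤ Nat.size (a + b) := by
  by_contra hlt
  have h1 : Nat.size (a + b) ≤ Nat.size a := by omega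
  rcases Nat.eq_zero_or_pos (Nat.size a) with h2 | h2
  · rw [h2, Nat.le_zero, Nat.size_eq_zero] at h1
    omega
  · have h3 := Nat.size_le.1 h1
    have h4 : 2 ^ (Nat.size a - 1) ≤ a := by
      rw [← Nat.lt_size]; omega
    have h5 : 2 ^ (Nat.size a) = 2 * 2 ^ (Nat.size a - 1) := by
      rw [← pow_succ']; congr 1; omega
    omega

theorem Buildable.append {U V : Word m} {e f : ℤ} {k l : ℕ} (hU : U ≠ []) (hV : V ≠ [])
    (dU : Der n1 n2 U e k) (dV : Der n1 n2 V f l)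
    (h0 : 0 < noA1 U + noA1 V)
    (bU : Buildable n1 n2 W U e k) (bV : Buildable n1 n2 W V f l) :
    Buildable n1 n2 W (U ++ V) (e + f) (k + l) := by
  intro P Z B K Bd hW hG hK hB hBd
  have hUl := List.length_pos_iff.2 hU
  have hVl := List.length_pos_iff.2 hV
  have hj : P.length + (U.length + V.length) ≤ W.length := by rw [hW]; simp
  rw [List.length_append] at hG ⊢
  rw [noA1_append] at hK
  rw [countA1_append] at hBd
  push_cast at hBd
  have hbU := dU.bound
  have hbV := dV.bound
  have hde := (dU.append dV).bound
  rw [countA1_append] at hde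
  push_cast at hde
  have he : |e| ≤ |e + f| + |f| := by simpa using abs_sub (e + f) f
  have hf : |f| ≤ |e + f| + |e| := by simpa using abs_sub (e + f) e
  have hbdU : |e| + countA1 U + (|n1| + |n2|) * k ≤ Bd := by linarith
  have hbdV : |f| + countA1 V + (|n1| + |n2|) * l ≤ Bd := by linarith
  have hsU : Nat.size (noA1 U) ≤ Nat.size (noA1 U + noA1 V) := Nat.size_le_size (by omega)
  have hsV : Nat.size (noA1 V) ≤ Nat.size (noA1 U + noA1 V) := Nat.size_le_size (by omega)
  have hPU : (P ++ U).length = P.length + U.length := by simp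
  -- it suffices to create both brackets
  suffices H : ∃ t k' l', t + 2 ≤ 3 * (U.length + V.length) ∧ k' ≤ k ∧ l' ≤ l ∧
      Reach n1 n2 W (QQ K Bd) t B (insert ⟨P.length, P.length + U.length, e, k'⟩
        (insert ⟨P.length + U.length, P.length + U.length + V.length, f, l'⟩ B)) by
    obtain ⟨t, k', l', ht, hk', hl', hR⟩ := H
    refine ⟨t + 1, k' + l', by omega, by omega, .tail _ _ _ _ hR ?_ ?_⟩
    · have hc : (⟨P.length + U.length, P.length + U.length + V.length, f, l'⟩ : PB) ∉ B :=
        hG.notMem (by simp) (by simp; omega)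
      have hne : (⟨P.length, P.length + U.length, e, k'⟩ : PB) ≠
          ⟨P.length + U.length, P.length + U.length + V.length, f, l'⟩ := by
        intro h; simp at h; exact hU h.1
      have hb : (⟨P.length, P.length + U.length, e, k'⟩ : PB) ∉
          (insert ⟨P.length + U.length, P.length + U.length + V.length, f, l'⟩ B : Finset PB) := by
        rw [Finset.mem_insert]
        rintro (h | h)
        · exact hne h
        · exact hG.notMem (by simp) (by simp) h
      have := Step.merge (n1 := n1) (n2 := n2) (W := W) _
        ⟨P.length, P.length + U.length, e, k'⟩
        ⟨P.length + U.length, P.length + U.length + V.length, f, l'⟩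
        ⟨P.length, P.length + (U.length + V.length), e + f, k' + l'⟩
        (Finset.mem_insert_self _ (insert ⟨P.length + U.length,
          P.length + U.length + V.length, f, l'⟩ B)) (by simp) hne rfl (by simp; omega)
        (by rw [Finset.erase_insert hb, Finset.erase_insert hc]
            exact hG.isPBS hj (by simp) (by simp) (by simp))
      rwa [Finset.erase_insert hb, Finset.erase_insert hc] at this
    · exact QQ.insert (by omega) hB (by simp only; linarith)
  have hk0 : 0 ≤ (|n1| + |n2|) * (k : ℤ) := by positivity
  have hl0 : 0 ≤ (|n1| + |n2|) * (l : ℤ) := by positivity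
  rcases le_total (noA1 V) (noA1 U) with hle | hle
  · have hh := size_half hle (by omega)
    rw [add_comm (noA1 V)] at hh
    obtain ⟨t1, k', ht1, hk', hR1⟩ := bU P (V ++ Z) B K Bd (by simp [hW])
      (hG.mono le_rfl (by omega)) (by omega) hB hbdU
    have hcard := Finset.card_insert_le (⟨P.length, P.length + U.length, e, k'⟩ : PB) B
    obtain ⟨t2, l', ht2, hl', hR2⟩ := bV (P ++ U) Z
      (insert ⟨P.length, P.length + U.length, e, k'⟩ B) K Bd (by simp [hW])
      (hG.insert hj (by simp) (by simp; omega) (by simp) (by simp) (by simp; omega) (by simp))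
      (by omega) (QQ.insert (K := B.card + 1) le_rfl hB (by simp only; linarith)).2 hbdV
    rw [hPU] at hR2
    refine ⟨t1 + t2, k', l', by omega, hk', hl', ?_⟩
    rw [Finset.insert_comm]
    exact hR1.trans hR2
  · have hh := size_half hle (by omega)
    obtain ⟨t1, l', ht1, hl', hR1⟩ := bV (P ++ U) Z B K Bd (by simp [hW])
      (hG.mono (by simp) (by simp; omega)) (by omega) hB hbdV
    rw [hPU] at hR1
    have hcard := Finset.card_insert_le
      (⟨P.length + U.length, P.length + U.length + V.length, f, l'⟩ : PB) B
    obtain ⟨t2, k', ht2, hk', hR2⟩ := bU P (V ++ Z)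
      (insert ⟨P.length + U.length, P.length + U.length + V.length, f, l'⟩ B) K Bd (by simp [hW])
      (hG.insert hj (by simp) (by simp; omega) (by simp; omega) (by simp) (by simp) (by simp))
      (by omega) (QQ.insert (K := B.card + 1) le_rfl hB (by simp only; linarith)).2 hbdU
    exact ⟨t1 + t2, k', l', by omega, hk', hl', hR1.trans hR2⟩

theorem Der.buildable (hn1 : n1 ≠ 0) (hn2 : n2 ≠ 0) {U : Word m} {e : ℤ} {k : ℕ}
    (h : Der n1 n2 U e k) : U ≠ [] → Buildable n1 n2 W U e k := by
  induction h with
  | nil k => intro h; exact absurd rfl h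
  | cons ε U e k h ih =>
    intro _
    by_cases hU : U = []
    · subst hU
      have := h.nil_inv
      subst this
      simpa using Buildable.single ε k
    · exact (ih hU).cons ε h
  | band x P Q e e' f c k l hc hP hQ ihP ihQ =>
    intro _
    have hb := Buildable.band (W := W) hn1 hn2 hc hP ihP
    have hx := hc.1
    by_cases hQ' : Q = []
    · subst hQ'
      have := hQ.nil_inv
      subst this
      intro P' Z B K Bd hW hG hK hB hBd
      have hl : 0 ≤ (|n1| + |n2|) * (l : ℤ) := by positivity
      push_cast at hBd
      simp only [add_zero] at hBd ⊢
      obtain ⟨t, k', ht, hk', hR⟩ := hb P' Z B K Bd hW hG hK hB (by push_cast; linarith)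
      exact ⟨t, k', ht, by omega, hR⟩
    · have hd : Der n1 n2 (x :: (P ++ [linv x])) e' (k + c) :=
        (Der.band x P [] e e' 0 c k 0 hc hP (.nil 0)).cast rfl (by ring) (by omega)
      have := hb.append (by simp) hQ' hd hQ (by rw [noA1_cons hx]; omega) (ihQ hQ')
      simpa using this

theorem cconst_ge : (3 : ℝ) ≤ Cconst := by
  have h1 : 0 < Real.logb 2 (6 / 5) := Real.logb_pos (by norm_num) (by norm_num)
  have h2 : 3 * Real.logb 2 (6 / 5) ≤ 1 := by
    have : 3 * Real.logb 2 (6 / 5) = Real.logb 2 ((6 / 5) ^ 3) := by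
      rw [Real.logb_pow]; norm_num
    rw [this, Real.logb_le_iff_le_rpow (by norm_num) (by norm_num)]
    norm_num
  rw [Cconst, le_inv_comm₀ (by norm_num) h1]
  linarith

theorem size_bound (L : ℕ) : ((1 + Nat.size L : ℕ) : ℝ) ≤
    Cconst * ((if L = 0 then (0 : ℝ) else Real.logb 2 (L : ℝ)) + 1) := by
  have hC := cconst_ge
  split_ifs with h
  · subst h; simp; linarith
  · have h1 : ((Nat.size L - 1 : ℕ) : ℝ) ≤ Real.logb 2 L := by
      have hL : 0 < L := Nat.pos_of_ne_zero h
      have hs : 0 < Nat.size L := Nat.size_pos.2 hL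
      rw [Real.le_logb_iff_rpow_le (by norm_num) (by exact_mod_cast hL), Real.rpow_natCast]
      have : 2 ^ (Nat.size L - 1) ≤ L := by rw [← Nat.lt_size]; omega
      exact_mod_cast this
    have h2 : (Nat.size L : ℝ) ≤ ((Nat.size L - 1 : ℕ) : ℝ) + 1 := by
      have : Nat.size L ≤ (Nat.size L - 1) + 1 := by omega
      exact_mod_cast this
    have h3 : (0 : ℝ) ≤ ((Nat.size L - 1 : ℕ) : ℝ) := by positivity
    push_cast at *
    nlinarith
end

/-- Lemma 6.13: a nonempty word `W` is a product of at most `n` conjugates of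
`(a_2 a_1^{n_1} a_2^{-1} a_1^{-n_2})^{±1}` in `F(A)` iff some sequence of elementary
operations transforms the empty pseudobracket system for `W` (with respect to
presentation (1.4)) into a final pseudobracket system `{(0, |W|, 0, n')}` with
`n' ≤ n`, of size bounded by `(7|W|, C(log|W|_{\bar a_1} + 1))` where
`C = (log (6/5))⁻¹` (with `log|W|_{\bar a_1} := 0` if `|W|_{\bar a_1} = 0`), and such
that every pseudobracket `b` of an intermediate pseudobracket system satisfies
`|b(3)| ≤ (|W|_{a_1} + (|n_1| + |n_2|)n)/2`. -/
theorem statement13 (m : ℕ) (n1 n2 : ℤ) (hn1 : n1 ≠ 0) (hn2 : n2 ≠ 0)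
    (W : Word m) (hW : W ≠ []) (n : ℕ) :
    (∃ k ≤ n, IsProdConj {relBS m n1 n2} k (evalW W)) ↔
    ∃ (ℓ : ℕ) (Bs : ℕ → Finset PB) (n' : ℕ),
      n' ≤ n ∧
      Bs 0 = ∅ ∧
      Bs ℓ = {(⟨0, W.length, 0, n'⟩ : PB)} ∧
      (∀ i < ℓ, Step m n1 n2 W (Bs i) (Bs (i + 1))) ∧
      ℓ ≤ 7 * W.length ∧
      (∀ i ≤ ℓ, ((Bs i).card : ℝ) ≤
        Cconst * ((if noA1 W = 0 then (0 : ℝ) else Real.logb 2 (noA1 W : ℝ)) + 1)) ∧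
      (∀ i ≤ ℓ, ∀ b ∈ Bs i, 2 * |b.c3| ≤ (countA1 W : ℤ) + (|n1| + |n2|) * (n : ℤ)) := by
  constructor
  · rintro ⟨k, hk, h⟩
    have hd := der_of_isProdConj hn1 hn2 h
    have hkn : (|n1| + |n2|) * (k : ℤ) ≤ (|n1| + |n2|) * (n : ℤ) := by gcongr
    obtain ⟨t, k', ht, hk', hR⟩ := hd.buildable (W := W) hn1 hn2 hW [] [] ∅
      (1 + Nat.size (noA1 W)) ((countA1 W : ℤ) + (|n1| + |n2|) * (n : ℤ)) (by simp)
      ⟨by simp, by simp⟩ (by simp) (by simp) (by simp only [abs_zero]; linarith)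
    obtain ⟨Bs, h0, h1, h2, h3⟩ := hR.seq
    refine ⟨t, Bs, k', by omega, h0, ?_, h2, by omega, ?_, ?_⟩
    · rw [h1]; simp
    · intro i hi
      refine le_trans ?_ (size_bound (noA1 W))
      exact_mod_cast (h3 i hi).1
    · intro i hi b hb
      exact (h3 i hi).2 b hb
  · rintro ⟨ℓ, Bs, n', hn', h0, hℓ, hs, -, -, -⟩
    have key : ∀ i ≤ ℓ, ∀ b ∈ Bs i, Sem n1 n2 W b := by
      intro i
      induction i with
      | zero => intro _ b hb; rw [h0] at hb; simp at hb
      | succ i ih => intro hi; exact sem_step hn1 hn2 (hs i (by omega)) (ih (by omega))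
    have := key ℓ le_rfl ⟨0, W.length, 0, n'⟩ (by rw [hℓ]; simp)
    refine ⟨n', hn', ?_⟩
    have h := this.isProdConj
    simpa [pre, evalW, ← FreeGroup.one_eq_mk] using h

end Stmt13
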